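/- Fix a field F and natural numbers M, K, t with 1 ≤ K ≤ M and t + 1 ≤ M. For each m ∈ {1,…,M} let B_m be a function assigning to every t-element subset T of {1,…,M} a value B_m(T) ∈ F, and assume there are coefficients c_{m,k} ∈ F (for m ∈ {K+1,…,M} and k ∈ {1,…,K}) such that B_m(T) = Σ_{k=1}^{K} c_{m,k} · B_k(T) for every m ∈ {K+1,…,M} and every t-element subset T. For each (t+1)-element subset S of {1,…,M}, with leaders ℓ_1 < … < ℓ_p (the elements of S ∩ {1,…,K}) and non-leaders n_1 < … < n_r (the elements of S \ {1,…,K}), define X_S = Σ_{a=1}^{p} (−1)^{a−1} · B_{ℓ_a}(S \ {ℓ_a}) − Σ_{b=1}^{r} (−1)^{b−1} · B_{n_b}(S \ {n_b}) ∈ F. Then the family { X_A : A a (t+1)-subset of {1,…,M} with A ∩ {1,…,K} ≠ ∅ }, which has binom(M, t+1) − binom(M−K, t+1) members, already F-linearly spans the whole set { X_S : S a (t+1)-subset of {1,…,M} }. -/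

import Mathlib

/-- The structure-minus multicast message `X_S`: the alternating-sign sum of
the subpackets of the leader messages (indices in `{1,…,K}`) of `S` minus the
alternating-sign sum of the subpackets of the non-leader messages of `S`,
where signs alternate in increasing order of the message index (the sign of a
symbol is `(-1)^(number of strictly smaller messages of the same kind in S)`). -/
def structureMinusQuery {F : Type*} [Field F] (K : ℕ) (B : ℕ → Finset ℕ → F)
    (S : Finset ℕ) : F :=
  (∑ x ∈ S ∩ Finset.Icc 1 K,
      (-1 : F) ^ ((S ∩ Finset.Icc 1 K).filter (fun y => y < x)).card * B x (S.erase x)) -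
    ∑ x ∈ S \ Finset.Icc 1 K,
      (-1 : F) ^ ((S \ Finset.Icc 1 K).filter (fun y => y < x)).card * B x (S.erase x)

/-- The sign `(-1)^(p(p+1)/2)`, which reconciles alternating signs taken separately over leaders and
non-leaders with alternating signs taken over all messages at once. -/
def leaderSign (F : Type*) [Field F] (p : ℕ) : F := (-1) ^ (p + 1).choose 2

theorem leaderSign_succ (F : Type*) [Field F] (p : ℕ) :
    leaderSign F (p + 1) = (-1) ^ (p + 1) * leaderSign F p := by
  unfold leaderSign
  rw [Nat.choose_succ_succ' (p + 1) 1, Nat.choose_one_right, pow_add]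

theorem leaderSign_mul_self (F : Type*) [Field F] (p : ℕ) :
    leaderSign F p * leaderSign F p = 1 := by
  unfold leaderSign
  rw [← mul_pow]; simp

/-- The minor of a tuple of vectors on the coordinates in `T`, as an alternating map. -/
def minorMap (F : Type*) [Field F] {t : ℕ} (T : Finset ℕ) (hT : T.card = t) :
    (ℕ → F) [⋀^Fin t]→ₗ[F] F :=
  Matrix.detRowAlternating.compLinearMap (LinearMap.funLeft F F (T.orderEmbOfFin hT))

theorem minorMap_single (F : Type*) [Field F] {t : ℕ} (T : Finset ℕ) (hT : T.card = t)
    (w : Fin t → ℕ) (hw : StrictMono w) :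
    minorMap F T hT (fun i => Pi.single (w i) 1) = if Finset.univ.image w = T then 1 else 0 := by
  have key : minorMap F T hT (fun i => Pi.single (w i) 1) =
      Matrix.det (fun i j => (Pi.single (w i) 1 : ℕ → F) (T.orderEmbOfFin hT j)) := rfl
  rw [key]
  split_ifs with h
  · have hwT : w = T.orderEmbOfFin hT := by
      refine Finset.orderEmbOfFin_unique hT (fun i => ?_) hw
      rw [← h]
      exact Finset.mem_image_of_mem _ (Finset.mem_univ i)
    rw [← Matrix.det_one (n := Fin t) (R := F)]
    congr 1
    funext i j
    rw [hwT, Matrix.one_apply, Pi.single_apply]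
    simp [eq_comm]
  · have : ∃ i, w i ∉ T := by
      by_contra! hall
      refine h (Finset.eq_of_subset_of_card_le ?_ ?_)
      · simpa [Finset.image_subset_iff] using hall
      · rw [Finset.card_image_of_injective _ hw.injective, hT]; simp
    obtain ⟨i, hi⟩ := this
    refine Matrix.det_eq_zero_of_row_eq_zero i (fun j => ?_)
    rw [Pi.single_apply, if_neg]
    intro h
    exact hi (h ▸ Finset.orderEmbOfFin_mem T hT j)

theorem alternatingMap_sum_apply {R E N ι κ : Type*} [Semiring R] [AddCommMonoid E] [Module R E]
    [AddCommMonoid N] [Module R N] (s : Finset κ) (f : κ → E [⋀^ι]→ₗ[R] N) (v : ι → E) :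
    (∑ k ∈ s, f k) v = ∑ k ∈ s, f k v := by
  induction s using Finset.cons_induction with
  | empty => simp
  | cons k s hk ih => simp [Finset.sum_cons, ih]

/-- The linear map sending the basis vector of a message `m` to the alternating map whose value on
the increasing basis tuple of a `t`-subset `T` is the subpacket `B m T`, up to a sign which
depends only on `T`. -/
def subpacketMap {F : Type*} [Field F] (M K t : ℕ) (B : ℕ → Finset ℕ → F) :
    (ℕ → F) →ₗ[F] (ℕ → F) [⋀^Fin t]→ₗ[F] F :=
  ∑ T : {T // T ∈ (Finset.Icc 1 M).powersetCard t},
    (leaderSign F ((T.1 ∩ Finset.Icc 1 K).card + 1) •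
      ∑ m ∈ Finset.Icc 1 M, B m T.1 • LinearMap.proj (R := F) (φ := fun _ : ℕ => F) m).smulRight
        (minorMap F T.1 (Finset.mem_powersetCard.1 T.2).2)

theorem subpacketMap_eq_zero {F : Type*} [Field F] (M K t : ℕ) (B : ℕ → Finset ℕ → F)
    (v : ℕ → F) (hv : ∀ T ⊆ Finset.Icc 1 M, T.card = t → ∑ m ∈ Finset.Icc 1 M, B m T * v m = 0) :
    subpacketMap M K t B v = 0 := by
  rw [subpacketMap, LinearMap.sum_apply]
  refine Finset.sum_eq_zero (fun T _ => ?_)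
  obtain ⟨h1, h2⟩ := Finset.mem_powersetCard.1 T.2
  simp [LinearMap.sum_apply, hv T.1 h1 h2]

theorem subpacketMap_single {F : Type*} [Field F] (M K t : ℕ) (B : ℕ → Finset ℕ → F)
    (m : ℕ) (hm : m ∈ Finset.Icc 1 M) (w : Fin t → ℕ) (hw : StrictMono w)
    (hwM : ∀ i, w i ∈ Finset.Icc 1 M) :
    subpacketMap M K t B (Pi.single m 1) (fun i => Pi.single (w i) 1) =
      leaderSign F ((Finset.univ.image w ∩ Finset.Icc 1 K).card + 1) *
        B m (Finset.univ.image w) := by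
  have hT : Finset.univ.image w ∈ (Finset.Icc 1 M).powersetCard t := by
    rw [Finset.mem_powersetCard, Finset.card_image_of_injective _ hw.injective]
    exact ⟨by simpa [Finset.image_subset_iff] using hwM, by simp⟩
  rw [subpacketMap, LinearMap.sum_apply, alternatingMap_sum_apply,
    Finset.sum_eq_single ⟨Finset.univ.image w, hT⟩]
  · simp only [LinearMap.smulRight_apply, AlternatingMap.smul_apply, minorMap_single F _ _ w hw,
      if_true, LinearMap.smul_apply, LinearMap.sum_apply, LinearMap.proj_apply, smul_eq_mul,
      Pi.single_apply, mul_ite, mul_one, mul_zero, Finset.sum_ite_eq', hm]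
  · intro T _ hne
    have : Finset.univ.image w ≠ T.1 := fun h => hne (Subtype.ext h.symm)
    simp [minorMap_single F _ _ w hw, this]
  · simp

theorem leaderSign_mul_structureMinusQuery {F : Type*} [Field F] (K : ℕ) (B : ℕ → Finset ℕ → F)
    (S : Finset ℕ) (hS : ∀ x ∈ S, 1 ≤ x) :
    leaderSign F (S ∩ Finset.Icc 1 K).card * structureMinusQuery K B S =
      ∑ x ∈ S, (-1) ^ (S.filter (· < x)).card *
        (leaderSign F ((S.erase x ∩ Finset.Icc 1 K).card + 1) * B x (S.erase x)) := by
  rw [← Finset.sum_inter_add_sum_sdiff S (Finset.Icc 1 K), structureMinusQuery, mul_sub,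
    sub_eq_add_neg, Finset.mul_sum, Finset.mul_sum, ← Finset.sum_neg_distrib]
  congr 1
  · refine Finset.sum_congr rfl (fun x hx => ?_)
    have hxK := (Finset.mem_Icc.1 (Finset.mem_inter.1 hx).2).2
    have h1 : S.filter (· < x) = (S ∩ Finset.Icc 1 K).filter (· < x) := by
      ext y
      simp only [Finset.mem_filter, Finset.mem_inter, Finset.mem_Icc]
      refine ⟨fun h => ⟨⟨h.1, hS y h.1, by omega⟩, h.2⟩, fun h => ⟨h.1.1, h.2⟩⟩
    have h2 : (S.erase x ∩ Finset.Icc 1 K).card + 1 = (S ∩ Finset.Icc 1 K).card := by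
      rw [Finset.erase_inter, Finset.card_erase_add_one hx]
    rw [h1, h2]
    ring
  · refine Finset.sum_congr rfl (fun x hx => ?_)
    obtain ⟨hxS, hxK⟩ := Finset.mem_sdiff.1 hx
    have hlt : K < x := by
      have := hS x hxS
      simp only [Finset.mem_Icc] at hxK
      omega
    have h1 : (S.filter (· < x)).card =
        (S ∩ Finset.Icc 1 K).card + ((S \ Finset.Icc 1 K).filter (· < x)).card := by
      rw [← Finset.card_inter_add_card_sdiff (S.filter (· < x)) (Finset.Icc 1 K)]
      congr 2
      · ext y
        simp only [Finset.mem_filter, Finset.mem_inter, Finset.mem_Icc]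
        refine ⟨fun h => ⟨h.1.1, h.2⟩, fun h => ⟨⟨h.1, by omega⟩, h.2⟩⟩
      · ext y
        simp only [Finset.mem_filter, Finset.mem_sdiff]
        tauto
    have h2 : S.erase x ∩ Finset.Icc 1 K = S ∩ Finset.Icc 1 K := by
      rw [Finset.erase_inter, Finset.erase_eq_of_notMem]
      simp only [Finset.mem_inter]
      tauto
    have h3 : ((-1 : F) ^ (S ∩ Finset.Icc 1 K).card) * (-1) ^ (S ∩ Finset.Icc 1 K).card = 1 := by
      rw [← mul_pow]; simp
    rw [h1, h2, leaderSign_succ, pow_add, pow_succ]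
    linear_combination (-(leaderSign F (S ∩ Finset.Icc 1 K).card *
      (-1) ^ ((S \ Finset.Icc 1 K).filter (· < x)).card * B x (S.erase x))) * (-h3)

/-- On increasing basis tuples, the alternatization of `subpacketMap` is the query, up to sign. -/
theorem alternatizeUncurryFin_subpacketMap {F : Type*} [Field F] (M K t : ℕ)
    (B : ℕ → Finset ℕ → F) (w : Fin (t + 1) → ℕ) (hw : StrictMono w)
    (hwM : ∀ i, w i ∈ Finset.Icc 1 M) :
    AlternatingMap.alternatizeUncurryFin (subpacketMap M K t B) (fun i => Pi.single (w i) 1) =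
      leaderSign F (Finset.univ.image w ∩ Finset.Icc 1 K).card *
        structureMinusQuery K B (Finset.univ.image w) := by
  rw [leaderSign_mul_structureMinusQuery, AlternatingMap.alternatizeUncurryFin_apply,
    Finset.sum_image (fun _ _ _ _ h => hw.injective h)]
  · refine Finset.sum_congr rfl (fun i _ => ?_)
    have h1 : ((Finset.univ.image w).filter (· < w i)).card = (i : ℕ) := by
      rw [Finset.filter_image, Finset.card_image_of_injective _ hw.injective]
      simp [hw.lt_iff_lt, Finset.filter_gt_eq_Iio]
    have h2 : Finset.univ.image (w ∘ i.succAbove) = (Finset.univ.image w).erase (w i) := by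
      rw [← Finset.image_image, ← Finset.image_erase hw.injective]
      congr 1
      ext j
      simp
    have h3 := subpacketMap_single M K t B (w i) (hwM i) (w ∘ i.succAbove)
      (hw.comp (Fin.strictMono_succAbove i)) (fun j => hwM _)
    rw [h1, ← h2, ← h3, zsmul_eq_mul]
    push_cast
    rfl
  · intro x hx
    obtain ⟨i, -, rfl⟩ := Finset.mem_image.1 hx
    exact (Finset.mem_Icc.1 (hwM i)).1

theorem card_powersetCard_filter_inter_nonempty (M K n : ℕ) :
    (((Finset.Icc 1 M).powersetCard n).filter
        (fun A => (A ∩ Finset.Icc 1 K).Nonempty)).card = M.choose n - (M - K).choose n := by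
  have h : ((Finset.Icc 1 M).powersetCard n).filter (fun A => ¬ (A ∩ Finset.Icc 1 K).Nonempty) =
      (Finset.Icc (K + 1) M).powersetCard n := by
    ext A
    simp only [Finset.mem_filter, Finset.mem_powersetCard, Finset.not_nonempty_iff_eq_empty,
      Finset.eq_empty_iff_forall_notMem, Finset.mem_inter, Finset.mem_Icc, Finset.subset_iff]
    constructor
    · rintro ⟨⟨h1, h2⟩, h3⟩
      refine ⟨fun x hx => ?_, h2⟩
      have := h1 hx
      have := h3 x
      simp only [hx, true_and] at this
      omega
    · rintro ⟨h1, h2⟩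
      refine ⟨⟨fun x hx => ?_, h2⟩, fun x hx => ?_⟩
      · have := h1 hx
        omega
      · have := h1 hx.1
        omega
  have h2 := Finset.card_filter_add_card_filter_not (s := (Finset.Icc 1 M).powersetCard n)
    (fun A => (A ∩ Finset.Icc 1 K).Nonempty)
  rw [h, Finset.card_powersetCard, Finset.card_powersetCard, Nat.card_Icc, Nat.card_Icc] at h2
  simp only [Nat.add_sub_cancel, Nat.add_sub_add_right] at h2
  omega

/-- A basis tuple involving a leader is sent to zero or, up to sign, to a query whose message set
meets the leaders. -/
theorem alternatizeUncurryFin_subpacketMap_mem_span {F : Type*} [Field F] (M K t : ℕ)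
    (B : ℕ → Finset ℕ → F) (w : Fin (t + 1) → ℕ) (hwM : ∀ i, w i ∈ Finset.Icc 1 M)
    (hwK : ∃ i, w i ∈ Finset.Icc 1 K) :
    AlternatingMap.alternatizeUncurryFin (subpacketMap M K t B) (fun i => Pi.single (w i) 1) ∈
      Submodule.span F ((fun A => structureMinusQuery K B A) ''
        (((Finset.Icc 1 M).powersetCard (t + 1)).filter
          (fun A => (A ∩ Finset.Icc 1 K).Nonempty) : Finset (Finset ℕ))) := by
  by_cases hinj : Function.Injective w
  · have hs : StrictMono (w ∘ Tuple.sort w) :=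
      (Tuple.monotone_sort w).strictMono_of_injective (hinj.comp (Tuple.sort w).injective)
    have h1 := alternatizeUncurryFin_subpacketMap M K t B _ hs (fun i => hwM _)
    have h2 := AlternatingMap.map_perm
      (AlternatingMap.alternatizeUncurryFin (subpacketMap M K t B))
      (fun i => Pi.single (w i) 1) (Tuple.sort w)
    have h3 := h2.symm.trans h1
    have hmem : structureMinusQuery K B (Finset.univ.image (w ∘ Tuple.sort w)) ∈
        Submodule.span F ((fun A => structureMinusQuery K B A) ''
          (((Finset.Icc 1 M).powersetCard (t + 1)).filter
            (fun A => (A ∩ Finset.Icc 1 K).Nonempty) : Finset (Finset ℕ))) := by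
      refine Submodule.subset_span (Set.mem_image_of_mem _ ?_)
      rw [Finset.mem_coe, Finset.mem_filter, Finset.mem_powersetCard,
        Finset.card_image_of_injective _ hs.injective]
      refine ⟨⟨?_, by simp⟩, ?_⟩
      · rw [Finset.image_subset_iff]
        exact fun i _ => hwM _
      · obtain ⟨i, hi⟩ := hwK
        refine ⟨w i, Finset.mem_inter.2 ⟨Finset.mem_image.2 ?_, hi⟩⟩
        exact ⟨(Tuple.sort w).symm i, Finset.mem_univ _, by simp⟩
    have hsign := Submodule.smul_mem _
      (leaderSign F (Finset.univ.image (w ∘ Tuple.sort w) ∩ Finset.Icc 1 K).card) hmem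
    rw [smul_eq_mul, ← h3] at hsign
    rcases Int.units_eq_one_or (Equiv.Perm.sign (Tuple.sort w)) with h | h
    · simpa [h] using hsign
    · simpa [h] using hsign
  · obtain ⟨i, j, hij, hne⟩ := Function.not_injective_iff.1 hinj
    rw [AlternatingMap.map_eq_zero_of_eq _ _ (by rw [hij]) hne]
    exact Submodule.zero_mem _

/-- If the non-leader messages depend linearly on the leaders, the alternatized subpacket map sends
basis tuples of non-leaders into the span of the queries meeting the leaders. -/
theorem alternatizeUncurryFin_subpacketMap_mem_span_of_dep {F : Type*} [Field F] {M K t : ℕ}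
    (hKM : K ≤ M) (c : ℕ → ℕ → F) (B : ℕ → Finset ℕ → F)
    (hdep : ∀ m ∈ Finset.Icc (K + 1) M, ∀ T ⊆ Finset.Icc 1 M, T.card = t →
      B m T = ∑ k ∈ Finset.Icc 1 K, c m k * B k T)
    (w : Fin (t + 1) → ℕ) (hwM : ∀ i, w i ∈ Finset.Icc 1 M) (hwK : ∀ i, w i ∉ Finset.Icc 1 K) :
    AlternatingMap.alternatizeUncurryFin (subpacketMap M K t B) (fun i => Pi.single (w i) 1) ∈
      Submodule.span F ((fun A => structureMinusQuery K B A) ''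
        (((Finset.Icc 1 M).powersetCard (t + 1)).filter
          (fun A => (A ∩ Finset.Icc 1 K).Nonempty) : Finset (Finset ℕ))) := by
  set Ξ := AlternatingMap.alternatizeUncurryFin (subpacketMap M K t B)
  let a : ℕ → ℕ → F := fun n j => (if j = n then 1 else 0) - if j ∈ Finset.Icc 1 K then c n j else 0
  let g : Fin (t + 1) → ℕ → F := fun i => ∑ j ∈ Finset.Icc 1 M, a (w i) j • Pi.single j 1
  have hg : ∀ i, subpacketMap M K t B (g i) = 0 := by
    refine fun i => subpacketMap_eq_zero M K t B _ (fun T hTM hT => ?_)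
    have hgm : ∀ m ∈ Finset.Icc 1 M, B m T * g i m =
        (if m = w i then B m T else 0) - if m ∈ Finset.Icc 1 K then c (w i) m * B m T else 0 := by
      intro m hm
      have : g i m = a (w i) m := by
        simp only [g, Finset.sum_apply, Pi.smul_apply, Pi.single_apply, smul_eq_mul, mul_ite,
          mul_one, mul_zero, Finset.sum_ite_eq, hm, if_true]
      rw [this]
      simp only [a]
      split_ifs <;> ring
    have hmem : w i ∈ Finset.Icc (K + 1) M := by
      have h1 := hwM i
      have h2 := hwK i
      simp only [Finset.mem_Icc] at h1 h2 ⊢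
      omega
    rw [Finset.sum_congr rfl hgm, Finset.sum_sub_distrib, Finset.sum_ite_eq', if_pos (hwM i),
      Finset.sum_ite_mem, Finset.inter_eq_right.2 (Finset.Icc_subset_Icc_right hKM),
      hdep _ hmem T hTM hT, sub_self]
  have hzero : Ξ g = 0 := by
    simp [Ξ, AlternatingMap.alternatizeUncurryFin_apply, hg]
  have hexp : Ξ g = ∑ r ∈ Fintype.piFinset (fun _ : Fin (t + 1) => Finset.Icc 1 M),
      (∏ i, a (w i) (r i)) • Ξ (fun i => Pi.single (r i) 1) := by
    refine (Ξ.toMultilinearMap.map_sum_finset (fun i j => a (w i) j • (Pi.single j 1 : ℕ → F))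
      (fun _ => Finset.Icc 1 M)).trans (Finset.sum_congr rfl (fun r _ => ?_))
    exact Ξ.toMultilinearMap.map_smul_univ _ _
  have hcoeff : ∏ i, a (w i) (w i) = 1 :=
    Finset.prod_eq_one (fun i _ => by simp only [a, if_true, if_neg (hwK i), sub_zero])
  rw [hzero, ← Finset.add_sum_erase _ _ (Fintype.mem_piFinset.2 hwM), hcoeff, one_smul] at hexp
  rw [eq_neg_of_add_eq_zero_left hexp.symm]
  refine Submodule.neg_mem _ (Submodule.sum_mem _ (fun r hr => ?_))
  obtain ⟨hne, hr⟩ := Finset.mem_erase.1 hr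
  by_cases hrK : ∃ i, r i ∈ Finset.Icc 1 K
  · exact Submodule.smul_mem _ _ (alternatizeUncurryFin_subpacketMap_mem_span M K t B r
      (Fintype.mem_piFinset.1 hr) hrK)
  · push Not at hrK
    obtain ⟨i, hi⟩ := Function.ne_iff.1 hne
    have : a (w i) (r i) = 0 := by simp only [a, if_neg hi, if_neg (hrK i), sub_zero]
    rw [Finset.prod_eq_zero (Finset.mem_univ i) this, zero_smul]
    exact Submodule.zero_mem _

/-- Counting form of the redundancy lemma: the `C(M,t+1) - C(M-K,t+1)` queries
whose message set meets the leaders `{1,…,K}` already span all the queries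
`X_S`, so the span of all the queries has dimension at most
`C(M,t+1) - C(M-K,t+1)`. -/
theorem stmt_6 (F : Type*) [Field F] (M K t : ℕ) (hK1 : 1 ≤ K) (hKM : K ≤ M)
    (htM : t + 1 ≤ M) (c : ℕ → ℕ → F) (B : ℕ → Finset ℕ → F)
    (hdep : ∀ m ∈ Finset.Icc (K + 1) M, ∀ T ⊆ Finset.Icc 1 M, T.card = t →
      B m T = ∑ k ∈ Finset.Icc 1 K, c m k * B k T) :
    (((Finset.Icc 1 M).powersetCard (t + 1)).filter
        (fun A => (A ∩ Finset.Icc 1 K).Nonempty)).card =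
      M.choose (t + 1) - (M - K).choose (t + 1) ∧
    (∀ S ∈ (Finset.Icc 1 M).powersetCard (t + 1),
      structureMinusQuery K B S ∈
        Submodule.span F
          ((fun A => structureMinusQuery K B A) ''
            (((Finset.Icc 1 M).powersetCard (t + 1)).filter
                (fun A => (A ∩ Finset.Icc 1 K).Nonempty) : Finset (Finset ℕ)))) ∧
    Module.finrank F
        (Submodule.span F
          ((fun A => structureMinusQuery K B A) ''
            ((Finset.Icc 1 M).powersetCard (t + 1) : Finset (Finset ℕ)))) ≤
      M.choose (t + 1) - (M - K).choose (t + 1) := by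
  have hspan : ∀ S ∈ (Finset.Icc 1 M).powersetCard (t + 1),
      structureMinusQuery K B S ∈
        Submodule.span F
          ((fun A => structureMinusQuery K B A) ''
            (((Finset.Icc 1 M).powersetCard (t + 1)).filter
                (fun A => (A ∩ Finset.Icc 1 K).Nonempty) : Finset (Finset ℕ))) := by
    intro S hS
    by_cases hSK : (S ∩ Finset.Icc 1 K).Nonempty
    · exact Submodule.subset_span
        (Set.mem_image_of_mem _ (Finset.mem_coe.2 (Finset.mem_filter.2 ⟨hS, hSK⟩)))
    obtain ⟨hSM, hcard⟩ := Finset.mem_powersetCard.1 hS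
    have hwM : ∀ i, S.orderEmbOfFin hcard i ∈ Finset.Icc 1 M :=
      fun i => hSM (Finset.orderEmbOfFin_mem S hcard i)
    have hwK : ∀ i, S.orderEmbOfFin hcard i ∉ Finset.Icc 1 K := fun i hi =>
      hSK ⟨_, Finset.mem_inter.2 ⟨Finset.orderEmbOfFin_mem S hcard i, hi⟩⟩
    have hX := alternatizeUncurryFin_subpacketMap M K t B _
      (S.orderEmbOfFin hcard).strictMono hwM
    rw [Finset.image_orderEmbOfFin_univ] at hX
    have hmem := alternatizeUncurryFin_subpacketMap_mem_span_of_dep hKM c B hdep _ hwM hwK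
    rw [hX] at hmem
    have hmul := Submodule.smul_mem _ (leaderSign F (S ∩ Finset.Icc 1 K).card) hmem
    rwa [smul_eq_mul, ← mul_assoc, leaderSign_mul_self, one_mul] at hmul
  refine ⟨card_powersetCard_filter_inter_nonempty M K (t + 1), hspan, ?_⟩
  rw [← card_powersetCard_filter_inter_nonempty M K (t + 1)]
  refine (Submodule.finrank_mono (Submodule.span_le.2 (Set.image_subset_iff.2 hspan))).trans ?_
  classical
  rw [← Finset.coe_image]
  exact (finrank_span_finset_le_card _).trans Finset.card_image_le
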